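/- arXiv:1712.06692 — 3 statements merged into one kernel-verified Lean document; each statement's English description precedes it below -/
import Mathlib

section
/- In the group G = ⟨a,b | a^m = b^n = 1, b⁻¹ab = a^r⟩ with gcd(m,n) = gcd(m,r-1) = 1 and r^n ≡ 1 (mod m), the subgroup generated by a^{m₁} and b^{n₁}a^s, where m₁ | m, n₁ | n, 0 ≤ s < m₁ and m₁ divides s·(r^n−1)/(r^{n₁}−1), has order mn/(m₁n₁). -/
/-- The relators of the Zassenhaus metacyclic group
`ZM(m,n,r) = ⟨a, b | a^m = b^n = 1, b⁻¹ab = a^r⟩`. -/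
def ZMrel (m n r : ℕ) : Set (FreeGroup (Fin 2)) :=
  {FreeGroup.of 0 ^ m, FreeGroup.of 1 ^ n,
   (FreeGroup.of 1)⁻¹ * FreeGroup.of 0 * FreeGroup.of 1 * (FreeGroup.of 0 ^ r)⁻¹}

/-- The ZM-group `ZM(m,n,r)` as a presented group. -/
abbrev ZM (m n r : ℕ) : Type := PresentedGroup (ZMrel m n r)

/-- The generator `a` of `ZM(m,n,r)`. -/
def za (m n r : ℕ) : ZM m n r := PresentedGroup.of 0

/-- The generator `b` of `ZM(m,n,r)`. -/
def zb (m n r : ℕ) : ZM m n r := PresentedGroup.of 1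

section Metacyclic

variable {G : Type*} [Group G] {a b : G} {m n r : ℕ}

theorem pow_mul_comm_of_conj (hab : b⁻¹ * a * b = a ^ r) (s t : ℕ) :
    a ^ s * b ^ t = b ^ t * a ^ (s * r ^ t) := by
  have key (s : ℕ) : a ^ s * b = b * a ^ (s * r) := by
    rw [mul_comm s, pow_mul, ← hab]
    have h := conj_pow (i := s) (a := b⁻¹) (b := a)
    rw [inv_inv] at h
    rw [h]
    group
  induction t with
  | zero => simp
  | succ t ih =>
    rw [pow_succ, ← mul_assoc, ih, mul_assoc, key, ← mul_assoc, mul_assoc s, ← pow_succ, ← pow_succ]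

theorem pow_mul_pow_pow_of_conj (hab : b⁻¹ * a * b = a ^ r) (s t k : ℕ) :
    (b ^ t * a ^ s) ^ k = b ^ (t * k) * a ^ (s * ∑ i ∈ Finset.range k, (r ^ t) ^ i) := by
  induction k with
  | zero => simp
  | succ k ih =>
    rw [pow_succ', ih, mul_assoc, ← mul_assoc (a ^ s), pow_mul_comm_of_conj hab,
      mul_assoc (b ^ (t * k)), ← mul_assoc (b ^ t), ← pow_add, ← pow_add,
      Finset.sum_range_succ, ← pow_mul]
    congr 2 <;> ring

theorem normal_zpowers_pow_of_conj (hgen : Subgroup.closure {a, b} = ⊤) (ha : IsOfFinOrder a)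
    (hab : b⁻¹ * a * b = a ^ r) (d : ℕ) : (Subgroup.zpowers (a ^ d)).Normal := by
  have hfin : Finite (Subgroup.zpowers (a ^ d) : Set G) :=
    finite_zpowers.2 ha.pow
  rw [← Subgroup.normalizer_eq_top_iff, eq_top_iff, ← hgen, Subgroup.closure_le]
  rintro g (rfl | rfl)
  · refine Subgroup.mem_normalizer_fintype ?_
    rintro _ ⟨i, rfl⟩
    refine ⟨i, ?_⟩
    simp only [← zpow_natCast, ← zpow_mul]
    group
  · rw [SetLike.mem_coe, ← inv_mem_iff]
    refine Subgroup.mem_normalizer_fintype ?_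
    rintro _ ⟨i, rfl⟩
    have h : g⁻¹ * a ^ d * g⁻¹⁻¹ = (a ^ d) ^ r := by
      rw [← conj_pow, inv_inv, hab, ← pow_mul, ← pow_mul, mul_comm]
    show g⁻¹ * (a ^ d) ^ i * g⁻¹⁻¹ ∈ Subgroup.zpowers (a ^ d)
    rw [← conj_zpow, h]
    exact zpow_mem (pow_mem (Subgroup.mem_zpowers _) _) _

theorem card_closure_of_conj {C : Type*} [Group C] (φ : G →* C)
    (hgen : Subgroup.closure {a, b} = ⊤) (hm : 0 < m) (hn : 0 < n)
    (ha : orderOf a = m) (hb : b ^ n = 1) (hab : b⁻¹ * a * b = a ^ r)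
    (hφa : φ a = 1) (hφb : orderOf (φ b) = n) {m₁ n₁ s : ℕ} (hm₁ : m₁ ∣ m) (hn₁ : n₁ ∣ n)
    (hs : m₁ ∣ s * ∑ i ∈ Finset.range (n / n₁), (r ^ n₁) ^ i) :
    Nat.card (Subgroup.closure {a ^ m₁, b ^ n₁ * a ^ s}) = m * n / (m₁ * n₁) := by
  set A := Subgroup.zpowers (a ^ m₁)
  set c := b ^ n₁ * a ^ s
  have : A.Normal :=
    normal_zpowers_pow_of_conj hgen (orderOf_pos_iff.1 (ha ▸ hm)) hab m₁
  have hcA : c ^ (n / n₁) ∈ A := by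
    rw [pow_mul_pow_pow_of_conj hab, Nat.mul_div_cancel' hn₁, hb, one_mul]
    obtain ⟨k, hk⟩ := hs
    rw [hk, pow_mul]
    exact pow_mem (Subgroup.mem_zpowers _) _
  have hφc : orderOf (φ c) = n / n₁ := by
    simp only [c, map_mul, map_pow, hφa, one_pow, mul_one]
    rw [orderOf_pow_of_dvd (Nat.pos_of_dvd_of_pos hn₁ hn).ne' (hφb ▸ hn₁), hφb]
  have hH : Subgroup.closure {a ^ m₁, c} = Subgroup.zpowers c ⊔ A := by
    rw [Set.insert_eq, Subgroup.closure_union, ← Subgroup.zpowers_eq_closure,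
      ← Subgroup.zpowers_eq_closure, sup_comm]
  rw [hH]
  have hAφ : A ≤ φ.ker := by
    rw [Subgroup.zpowers_le, MonoidHom.mem_ker, map_pow, hφa, one_pow]
  have hker : φ.ker ⊓ (Subgroup.zpowers c ⊔ A) = A := by
    refine le_antisymm ?_ (le_inf hAφ le_sup_right)
    rintro x ⟨hx, hxH⟩
    obtain ⟨_, ⟨i, rfl⟩, z, hz, rfl⟩ := Subgroup.mem_sup_of_normal_right.1 hxH
    refine mul_mem ?_ hz
    have hi : φ c ^ i = 1 := by
      simpa [MonoidHom.mem_ker.1 (hAφ hz)] using MonoidHom.mem_ker.1 hx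
    obtain ⟨j, rfl⟩ := orderOf_dvd_iff_zpow_eq_one.2 hi
    show c ^ _ ∈ A
    rw [hφc, zpow_mul, zpow_natCast]
    exact zpow_mem hcA j
  have hmap : (Subgroup.zpowers c ⊔ A).map φ = Subgroup.zpowers (φ c) := by
    rw [Subgroup.map_sup, MonoidHom.map_zpowers, (Subgroup.map_eq_bot_iff A).2 hAφ, sup_bot_eq]
  have hrel : A.relIndex (Subgroup.zpowers c ⊔ A) = n / n₁ := by
    have h := Subgroup.inf_relIndex_right φ.ker (Subgroup.zpowers c ⊔ A)
    rw [hker] at h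
    rw [h, Subgroup.relIndex_ker, hmap, Nat.card_zpowers, hφc]
  rw [← Subgroup.relIndex_bot_left, ← Subgroup.relIndex_mul_relIndex ⊥ A _ bot_le le_sup_right,
    hrel, Subgroup.relIndex_bot_left, Nat.card_zpowers,
    orderOf_pow_of_dvd (Nat.pos_of_dvd_of_pos hm₁ hm).ne' (ha ▸ hm₁), ha,
    Nat.div_mul_div_comm hm₁ hn₁]

end Metacyclic

section ZM

variable {m n r : ℕ}

theorem za_pow : za m n r ^ m = 1 :=
  PresentedGroup.one_of_mem (rels := ZMrel m n r) (x := FreeGroup.of 0 ^ m) (by simp [ZMrel])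

theorem zb_pow : zb m n r ^ n = 1 :=
  PresentedGroup.one_of_mem (rels := ZMrel m n r) (x := FreeGroup.of 1 ^ n) (by simp [ZMrel])

theorem zb_conj_za : (zb m n r)⁻¹ * za m n r * zb m n r = za m n r ^ r :=
  mul_inv_eq_one.1 <| PresentedGroup.one_of_mem (rels := ZMrel m n r)
    (x := (FreeGroup.of 1)⁻¹ * FreeGroup.of 0 * FreeGroup.of 1 * (FreeGroup.of 0 ^ r)⁻¹)
    (by simp [ZMrel])

theorem closure_za_zb : Subgroup.closure {za m n r, zb m n r} = ⊤ := by
  rw [← PresentedGroup.closure_range_of (ZMrel m n r)]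
  congr 1
  ext x
  simp [Fin.exists_fin_two, za, zb, eq_comm]

theorem exists_ZM_hom {G : Type*} [Group G] {x y : G} (hx : x ^ m = 1) (hy : y ^ n = 1)
    (hxy : y⁻¹ * x * y = x ^ r) :
    ∃ φ : ZM m n r →* G, φ (za m n r) = x ∧ φ (zb m n r) = y := by
  have h : ∀ w ∈ ZMrel m n r, FreeGroup.lift ![x, y] w = 1 := by
    rintro _ (rfl | rfl | rfl) <;> simp [hx, hy, hxy]
  exact ⟨PresentedGroup.toGroup h, PresentedGroup.toGroup.of h, PresentedGroup.toGroup.of h⟩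

theorem orderOf_za (hn : n ≠ 0) (hr : r ^ n ≡ 1 [MOD m]) : orderOf (za m n r) = m := by
  refine Nat.dvd_antisymm (orderOf_dvd_of_pow_eq_one za_pow) ?_
  have hu : (r : ZMod m) ^ n = 1 := by
    exact_mod_cast (ZMod.natCast_eq_natCast_iff _ _ _).2 hr
  obtain ⟨u, hur⟩ : IsUnit (r : ZMod m) := .of_pow_eq_one hu hn
  have hun : u ^ n = 1 := by ext; simpa [hur] using hu
  have hpow (k : ℕ) : Equiv.addRight (1 : ZMod m) ^ k = Equiv.addRight (k : ZMod m) := by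
    induction k with
    | zero => ext; simp
    | succ k ih => rw [pow_succ, ih]; ext x; simp [add_assoc, add_comm, add_left_comm]
  obtain ⟨φ, hφa, -⟩ := exists_ZM_hom (m := m) (n := n) (r := r)
    (x := Equiv.addRight (1 : ZMod m)) (y := MulAction.toPermHom (ZMod m)ˣ (ZMod m) u⁻¹)
    (by rw [hpow]; ext; simp)
    (by rw [← map_pow, inv_pow, hun, inv_one, map_one])
    (by
      rw [hpow, ← map_inv, inv_inv]
      ext x
      simp [Units.smul_def, ← hur])
  have h := congrArg φ (pow_orderOf_eq_one (za m n r))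
  rw [map_pow, hφa, map_one, hpow] at h
  exact (ZMod.natCast_eq_zero_iff _ _).1 (by simpa using Equiv.congr_fun h 0)

end ZM

/-- The subgroup `H(m₁,n₁,s) = ⟨a^{m₁}, b^{n₁}a^s⟩` of `ZM(m,n,r)` has order
`mn/(m₁n₁)`. -/
theorem card_ZM_subgroup (m n r m₁ n₁ s : ℕ)
    (hm : 0 < m) (hn : 0 < n) (hr : 0 < r)
    (h1 : Nat.gcd m n = 1) (h2 : Nat.gcd m (r - 1) = 1) (h3 : r ^ n ≡ 1 [MOD m])
    (hm₁ : m₁ ∣ m) (hn₁ : n₁ ∣ n) (hs : s < m₁)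
    (hsdvd : m₁ ∣ s * ((r ^ n - 1) / (r ^ n₁ - 1))) :
    Nat.card (Subgroup.closure {za m n r ^ m₁, zb m n r ^ n₁ * za m n r ^ s}
      : Subgroup (ZM m n r)) = m * n / (m₁ * n₁) := by
  have hm₁0 := Nat.pos_of_dvd_of_pos hm₁ hm
  have hn₁0 := Nat.pos_of_dvd_of_pos hn₁ hn
  obtain ⟨φ, hφa, hφb⟩ := exists_ZM_hom (m := m) (n := n) (r := r)
    (x := (1 : Multiplicative (ZMod n))) (y := Multiplicative.ofAdd 1)
    (one_pow m) (by rw [← ofAdd_nsmul]; simp) (by simp)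
  refine card_closure_of_conj φ closure_za_zb hm hn (orderOf_za hn.ne' h3) zb_pow zb_conj_za hφa
    (by rw [hφb, orderOf_ofAdd_eq_addOrderOf, ZMod.addOrderOf_one]) hm₁ hn₁ ?_
  obtain rfl | hr2 : r = 1 ∨ 2 ≤ r := by omega
  · have hm_one : m = 1 := by simpa using h2
    subst hm_one
    simp [Nat.dvd_one.1 hm₁]
  · rwa [Nat.geomSum_eq (hr2.trans (Nat.le_self_pow hn₁0.ne' r)), ← pow_mul,
      Nat.mul_div_cancel' hn₁]
end

section
/- For a finite group G all of whose Sylow subgroups are cyclic, the poset of conjugacy classes of subgroups of G (ordered by [H₁] ≤ [H₂] iff H₁ is contained in some conjugate of H₂) is isomorphic to the lattice of divisors of |G|. -/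
/-- The setoid on subgroups of `G` identifying conjugate subgroups. -/
def conjSetoid (G : Type*) [Group G] : Setoid (Subgroup G) where
  r H K := ∃ g : G, Subgroup.map (MulAut.conj g).toMonoidHom H = K
  iseqv := by
    constructor
    · intro H
      exact ⟨1, by ext x; simp⟩
    · rintro H K ⟨g, rfl⟩
      refine ⟨g⁻¹, ?_⟩
      rw [Subgroup.map_map]
      convert Subgroup.map_id H
      ext x
      simp [mul_assoc, mul_inv_cancel_left]
    · rintro H K L ⟨g, rfl⟩ ⟨g', rfl⟩
      refine ⟨g' * g, ?_⟩
      rw [Subgroup.map_map]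
      congr 1
      ext x
      simp [mul_assoc]

section ConjugateComplements

open scoped IsMulCommutative Pointwise

namespace Subgroup

variable {G : Type*} [Group G]

theorem subgroupOf_disjoint {H K : Subgroup G} (L : Subgroup G) (h : Disjoint H K) :
    Disjoint (H.subgroupOf L) (K.subgroupOf L) := by
  rw [disjoint_iff, subgroupOf, subgroupOf, ← comap_inf, h.eq_bot]
  exact bot_subgroupOf L

theorem IsComplement'.exists_le_stabilizer {N H : Subgroup G} [N.Normal] [IsMulCommutative N]
    [N.FiniteIndex] (h : IsComplement' N H) :
    ∃ α : N.QuotientDiff, H ≤ MulAction.stabilizer G α := by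
  let T : N.LeftTransversal := ⟨(H : Set G), h.symm⟩
  refine ⟨Quotient.mk'' T, fun x hx => ?_⟩
  refine congrArg Quotient.mk'' (Subtype.ext ?_)
  ext y
  change y ∈ MulOpposite.op x⁻¹ • (H : Set G) ↔ y ∈ (H : Set G)
  rw [Set.mem_smul_set_iff_inv_smul_mem]
  simpa using H.mul_mem_cancel_right hx

/-- The conjugacy part of the Schur-Zassenhaus theorem for an abelian normal Hall subgroup. -/
theorem IsComplement'.exists_map_conj_eq [Finite G] {N H K : Subgroup G} [N.Normal]
    [IsMulCommutative N] (hN : (Nat.card N).Coprime N.index)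
    (hH : IsComplement' N H) (hK : IsComplement' N K) :
    ∃ g : G, H.map (MulAut.conj g).toMonoidHom = K := by
  obtain ⟨α, hα⟩ := hH.exists_le_stabilizer
  obtain ⟨β, hβ⟩ := hK.exists_le_stabilizer
  obtain ⟨n, rfl⟩ := exists_smul_eq hN α β
  have key {L : Subgroup G} (hL : IsComplement' N L) {γ : N.QuotientDiff}
      (h : L ≤ MulAction.stabilizer G γ) : L = MulAction.stabilizer G γ := by
    refine eq_of_le_of_card_ge h (le_of_eq ?_)
    rw [← hL.symm.index_eq_card, ← (isComplement'_stabilizer_of_coprime hN).symm.index_eq_card]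
  refine ⟨n, ?_⟩
  rw [key hH hα, key hK hβ]
  exact (MulAction.stabilizer_smul_eq_stabilizer_map_conj (n : G) α).symm

theorem exists_map_conj_le_of_coprime [Finite G] {N C D : Subgroup G} [N.Normal]
    [IsMulCommutative N] (hC : IsComplement' N C) (hD : (Nat.card N).Coprime (Nat.card D)) :
    ∃ g : G, D.map (MulAut.conj g).toMonoidHom ≤ C := by
  set L := N ⊔ D
  have hNL : N ≤ L := le_sup_left
  have hDL : D ≤ L := le_sup_right
  have hDc : IsComplement' (N.subgroupOf L) (D.subgroupOf L) := by
    refine isComplement'_of_disjoint_and_mul_eq_univ ?_ ?_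
    · exact subgroupOf_disjoint L (disjoint_of_coprime_natCard hD)
    · refine Set.eq_univ_of_forall fun x => ?_
      obtain ⟨n, hn, d, hd, h⟩ := mem_sup_of_normal_left.mp x.2
      exact ⟨⟨n, hNL hn⟩, hn, ⟨d, hDL hd⟩, hd, Subtype.ext h⟩
  have hCc : IsComplement' (N.subgroupOf L) (C.subgroupOf L) := by
    refine isComplement'_of_disjoint_and_mul_eq_univ ?_ ?_
    · exact subgroupOf_disjoint L hC.disjoint
    · refine Set.eq_univ_of_forall fun x => ?_
      obtain ⟨n, hn, c, hc, h⟩ := mem_sup_of_normal_left.mp (hC.sup_eq_top.ge (mem_top (x : G)))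
      have hcL : c ∈ L := by
        rw [← eq_inv_mul_iff_mul_eq] at h
        exact h ▸ L.mul_mem (L.inv_mem (hNL hn)) x.2
      exact ⟨⟨n, hNL hn⟩, hn, ⟨c, hcL⟩, hc, Subtype.ext h⟩
  have : IsMulCommutative (N.subgroupOf L) :=
    ⟨⟨fun a b => Subtype.ext <| Subtype.ext <| setLike_mul_comm (s := N) a.2 b.2⟩⟩
  have hcop : (Nat.card (N.subgroupOf L)).Coprime (N.subgroupOf L).index := by
    rw [hDc.symm.index_eq_card, Nat.card_congr (subgroupOfEquivOfLe hNL).toEquiv,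
      Nat.card_congr (subgroupOfEquivOfLe hDL).toEquiv]
    exact hD
  obtain ⟨g, hg⟩ := hDc.exists_map_conj_eq hcop hCc
  refine ⟨g, ?_⟩
  rintro _ ⟨d, hd, rfl⟩
  have hmem : (⟨d, hDL hd⟩ : L) ∈ D.subgroupOf L := hd
  exact hg.le (mem_map_of_mem (MulAut.conj g).toMonoidHom hmem)

end Subgroup

end ConjugateComplements

namespace Subgroup

variable {G : Type*} [Group G]

theorem le_of_card_dvd_of_isCyclic [Finite G] {A S T : Subgroup G} [IsCyclic A] (hS : S ≤ A)
    (hT : T ≤ A)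
    (h : Nat.card S ∣ Nat.card T) : S ≤ T := by
  let : CommGroup A := IsCyclic.commGroup
  have hker : T.subgroupOf A = (powMonoidHom (Nat.card T) : A →* A).ker := by
    refine eq_of_le_of_card_ge (fun x hx => ?_) (le_of_eq ?_)
    · exact Subtype.ext (orderOf_dvd_iff_pow_eq_one.mp (T.orderOf_dvd_natCard hx))
    · rw [IsCyclic.card_powMonoidHom_ker, Nat.card_congr (subgroupOfEquivOfLe hT).toEquiv,
        Nat.gcd_eq_right (card_dvd_of_le hT)]
  intro x hx
  have hxT : (⟨x, hS hx⟩ : A) ∈ T.subgroupOf A := by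
    rw [hker]
    exact Subtype.ext (orderOf_dvd_iff_pow_eq_one.mp ((S.orderOf_dvd_natCard hx).trans h))
  exact hxT

theorem exists_le_card_eq_of_isCyclic [Finite G] (A : Subgroup G) [IsCyclic A] {d : ℕ}
    (hd : d ∣ Nat.card A) : ∃ S ≤ A, Nat.card S = d := by
  obtain ⟨a, ha⟩ := IsCyclic.exists_ofOrder_eq_natCard (α := A)
  obtain ⟨k, hk⟩ := hd
  have hpos : 0 < d * k := hk ▸ Nat.card_pos
  refine ⟨zpowers ((a : G) ^ k), zpowers_le.mpr (A.pow_mem a.2 k), ?_⟩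
  rw [Nat.card_zpowers, orderOf_pow, orderOf_coe, ha, hk, Nat.gcd_mul_left_left,
    Nat.mul_div_cancel _ (Nat.pos_of_mul_pos_left hpos)]

theorem card_sup_of_disjoint {A B : Subgroup G} [A.Normal] (h : Disjoint A B) :
    Nat.card (A ⊔ B : Subgroup G) = Nat.card A * Nat.card B := by
  rw [← relIndex_bot_left (A ⊔ B), ← relIndex_mul_relIndex ⊥ A (A ⊔ B) bot_le le_sup_left,
    relIndex_bot_left, relIndex_sup_left, ← inf_relIndex_right,
    h.eq_bot, relIndex_bot_left]

theorem exists_inf_sup_eq_of_coprime {N : Subgroup G} [N.Normal]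
    (hN : (Nat.card N).Coprime N.index) (H : Subgroup G) :
    ∃ D : Subgroup G, (N ⊓ H) ⊔ D = H ∧ Nat.card (N ⊓ H : Subgroup G) * Nat.card D = Nat.card H ∧
      Nat.card D ∣ N.index := by
  have hcard : Nat.card (N.subgroupOf H) = Nat.card (N ⊓ H : Subgroup G) := by
    rw [← subgroupOf_map_subtype, card_map_of_injective H.subtype_injective]
  have hidx : (N.subgroupOf H).index ∣ N.index := relIndex_dvd_index_of_normal N H
  have hcop : (Nat.card (N.subgroupOf H)).Coprime (N.subgroupOf H).index :=
    (hN.coprime_dvd_left (hcard ▸ card_dvd_of_le inf_le_left)).coprime_dvd_right hidx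
  obtain ⟨D, hD⟩ := exists_right_complement'_of_coprime hcop
  have hcardD : Nat.card (D.map H.subtype) = Nat.card D :=
    card_map_of_injective H.subtype_injective
  refine ⟨D.map H.subtype, ?_, ?_, ?_⟩
  · rw [← subgroupOf_map_subtype, ← map_sup, hD.sup_eq_top, ← MonoidHom.range_eq_map,
      range_subtype]
  · rw [hcardD, ← hcard, hD.card_mul_card]
  · rwa [hcardD, ← hD.symm.index_eq_card]

end Subgroup

namespace IsZGroup

open Subgroup

variable {G : Type*} [Group G] [Finite G] [IsZGroup G]

variable (G) in
theorem exists_isCyclic_isComplement' :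
    ∃ C : Subgroup G, IsCyclic C ∧ IsComplement' (commutator G) C := by
  obtain ⟨C, hC⟩ := exists_right_complement'_of_coprime (coprime_commutator_index G)
  have : IsCyclic (G ⧸ commutator G) := isCyclic_abelianization
  exact ⟨C, hC.symm.QuotientMulEquiv.isCyclic.mp this, hC⟩

theorem exists_card_eq {d : ℕ} (hd : d ∣ Nat.card G) : ∃ H : Subgroup G, Nat.card H = d := by
  have := isCyclic_commutator (G := G)
  obtain ⟨C, _, hC⟩ := exists_isCyclic_isComplement' G
  obtain ⟨A, hA, hAcard⟩ := exists_le_card_eq_of_isCyclic (commutator G) (Nat.gcd_dvd_right d _)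
  obtain ⟨B, hB, hBcard⟩ := exists_le_card_eq_of_isCyclic C (Nat.gcd_dvd_right d _)
  have : A.Normal := by
    refine ⟨fun a ha g => ?_⟩
    have hle : A.map (MulAut.conj g).toMonoidHom ≤ commutator G :=
      (map_mono hA).trans (Normal.map_conj_eq _ g).le
    refine le_of_card_dvd_of_isCyclic hle hA ?_ (mem_map_of_mem _ ha)
    rw [card_map_of_injective (MulAut.conj g).injective]
  have hcop : (Nat.card (commutator G)).Coprime (Nat.card C) :=
    hC.symm.index_eq_card ▸ coprime_commutator_index G
  refine ⟨A ⊔ B, ?_⟩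
  rw [card_sup_of_disjoint (hC.disjoint.mono hA hB), hAcard, hBcard, ← hcop.gcd_mul,
    hC.card_mul_card, Nat.gcd_eq_left hd]

theorem exists_le_map_conj_iff {H K : Subgroup G} :
    (∃ g : G, H ≤ K.map (MulAut.conj g).toMonoidHom) ↔ Nat.card H ∣ Nat.card K := by
  have hcard (g : G) (L : Subgroup G) :
      Nat.card (L.map (MulAut.conj g).toMonoidHom) = Nat.card L :=
    card_map_of_injective (MulAut.conj g).injective
  refine ⟨fun ⟨g, hg⟩ => hcard g K ▸ card_dvd_of_le hg, fun h => ?_⟩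
  have := isCyclic_commutator (G := G)
  have hN := coprime_commutator_index G
  obtain ⟨C, _, hC⟩ := exists_isCyclic_isComplement' G
  obtain ⟨D, hHD, hDmul, hD⟩ := exists_inf_sup_eq_of_coprime hN H
  obtain ⟨E, hKE, hEmul, hE⟩ := exists_inf_sup_eq_of_coprime hN K
  obtain ⟨n, hn⟩ := exists_map_conj_le_of_coprime hC (hN.coprime_dvd_right hD)
  obtain ⟨m, hm⟩ := exists_map_conj_le_of_coprime hC (hN.coprime_dvd_right hE)
  have hNcard (L : Subgroup G) : Nat.card (commutator G ⊓ L : Subgroup G) ∣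
      Nat.card (commutator G) := card_dvd_of_le inf_le_left
  rw [← hDmul, ← hEmul] at h
  have hNdvd := ((hN.coprime_dvd_left (hNcard H)).coprime_dvd_right hE).dvd_of_dvd_mul_right
    ((dvd_mul_right _ _).trans h)
  have hCdvd := ((hN.coprime_dvd_left (hNcard K)).coprime_dvd_right hD).symm.dvd_of_dvd_mul_left
    ((dvd_mul_left _ _).trans h)
  have hconj : H.map (MulAut.conj n).toMonoidHom ≤ K.map (MulAut.conj m).toMonoidHom := by
    rw [← hHD, ← hKE, Subgroup.map_sup, Subgroup.map_sup]
    refine sup_le_sup ?_ ?_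
    · refine le_of_card_dvd_of_isCyclic (A := commutator G) ?_ ?_ (by rwa [hcard, hcard]) <;>
        exact (map_mono inf_le_left).trans (Normal.map_conj_eq _ _).le
    · exact le_of_card_dvd_of_isCyclic hn hm (by rwa [hcard, hcard])
  refine ⟨n⁻¹ * m, fun x hx => ?_⟩
  obtain ⟨y, hy, hxy⟩ := hconj (mem_map_of_mem _ hx)
  refine ⟨y, hy, ?_⟩
  change n⁻¹ * m * y * (n⁻¹ * m)⁻¹ = x
  change m * y * m⁻¹ = n * x * n⁻¹ at hxy
  calc n⁻¹ * m * y * (n⁻¹ * m)⁻¹ = n⁻¹ * (m * y * m⁻¹) * n := by group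
    _ = x := by rw [hxy]; group

end IsZGroup

/-- For a finite group all of whose Sylow subgroups are cyclic, the poset of
conjugacy classes of subgroups (ordered by `[H₁] ≤ [H₂]` iff `H₁` is contained in
some conjugate of `H₂`) is isomorphic to the lattice of divisors of `|G|`. -/
theorem conjClasses_orderIso_divisors {G : Type*} [Group G] [Finite G]
    (hsyl : ∀ p : ℕ, p.Prime → ∀ P : Sylow p G, IsCyclic P) :
    ∃ e : Quotient (conjSetoid G) ≃ {d : ℕ // d ∣ Nat.card G},
      ∀ H K : Subgroup G,
        (∃ g : G, H ≤ Subgroup.map (MulAut.conj g).toMonoidHom K) ↔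
          (e ⟦H⟧ : ℕ) ∣ (e ⟦K⟧ : ℕ) := by
  have : IsZGroup G := ⟨hsyl⟩
  have hcard (g : G) (L : Subgroup G) :
      Nat.card (L.map (MulAut.conj g).toMonoidHom) = Nat.card L :=
    Subgroup.card_map_of_injective (MulAut.conj g).injective
  let f : Quotient (conjSetoid G) → {d : ℕ // d ∣ Nat.card G} :=
    Quotient.lift (fun H => ⟨Nat.card H, H.card_subgroup_dvd_card⟩) <| by
      rintro H _ ⟨g, rfl⟩
      exact Subtype.ext (hcard g H).symm
  have hf : Function.Bijective f := by
    refine ⟨?_, fun ⟨d, hd⟩ => ?_⟩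
    · rintro ⟨H⟩ ⟨K⟩ hHK
      have hHK : Nat.card H = Nat.card K := congrArg Subtype.val hHK
      obtain ⟨g, hg⟩ := IsZGroup.exists_le_map_conj_iff.mpr hHK.symm.dvd
      refine Quotient.sound ⟨g, ?_⟩
      exact (Subgroup.eq_of_le_of_card_ge hg (by rw [hcard, hHK])).symm
    · obtain ⟨H, rfl⟩ := IsZGroup.exists_card_eq hd
      exact ⟨⟦H⟧, rfl⟩
  exact ⟨Equiv.ofBijective f hf, fun _ _ => IsZGroup.exists_le_map_conj_iff⟩
end

section
/- In ZM(m,n,r), the conjugacy class of the subgroup H(m_i, n_i, 0) = ⟨a^{m_i}, b^{n_i}⟩ has size gcd(m_i, (r^n−1)/(r^{n_i}−1)). -/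
theorem Nat.div_gcd_eq_gcd_of_dvd_mul {k A Q : ℕ} (hk : 0 < k) (hdvd : k ∣ A * Q)
    (hco : Nat.Coprime (Nat.gcd k A) Q) : k / Nat.gcd k A = Nat.gcd k Q := by
  refine Nat.div_eq_of_eq_mul_right (Nat.gcd_pos_of_pos_left _ hk) (Nat.dvd_antisymm ?_ ?_)
  · exact (Nat.gcd_eq_left hdvd).symm.dvd.trans (Nat.gcd_mul_right_dvd_mul_gcd k A Q)
  · exact (Nat.Coprime.coprime_dvd_right (Nat.gcd_dvd_right k Q) hco).mul_dvd_of_dvd_of_dvd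
      (Nat.gcd_dvd_left _ _) (Nat.gcd_dvd_left _ _)

theorem Nat.coprime_gcd_pow_sub_one_geomSum {k r d e : ℕ} (hr : 0 < r) (hco : Nat.Coprime k e) :
    Nat.Coprime (Nat.gcd k (r ^ d - 1)) (∑ i ∈ Finset.range e, (r ^ d) ^ i) := by
  have hmod : ∑ i ∈ Finset.range e, (r ^ d) ^ i ≡ e [MOD Nat.gcd k (r ^ d - 1)] := by
    have h1 : r ^ d ≡ 1 [MOD Nat.gcd k (r ^ d - 1)] :=
      ((Nat.modEq_iff_dvd' (Nat.one_le_pow _ _ hr)).2 (Nat.gcd_dvd_right _ _)).symm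
    rw [← ZMod.natCast_eq_natCast_iff] at h1 ⊢
    rw [Nat.cast_sum]
    simp only [Nat.cast_pow (r ^ d), h1, Nat.cast_one, one_pow, Finset.sum_const,
      Finset.card_range, nsmul_eq_mul, mul_one]
  rw [Nat.coprime_comm, Nat.Coprime, hmod.gcd_eq, ← Nat.Coprime, Nat.coprime_comm]
  exact hco.coprime_dvd_left (Nat.gcd_dvd_left _ _)

theorem div_gcd_pow_sub_one_eq {n r k d : ℕ} (hk : 0 < k) (hn : 0 < n) (hr : 0 < r)
    (hkn : Nat.Coprime k n) (hkr : Nat.gcd k (r - 1) = 1) (hrn : r ^ n ≡ 1 [MOD k])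
    (hd : d ∣ n) : k / Nat.gcd k (r ^ d - 1) = Nat.gcd k ((r ^ n - 1) / (r ^ d - 1)) := by
  obtain ⟨e, rfl⟩ := hd
  rcases Nat.eq_or_lt_of_le hr with rfl | hr1
  · simp_all
  have hd0 : d ≠ 0 := by rintro rfl; simp at hn
  have hpos : 0 < r ^ d - 1 := Nat.sub_pos_of_lt (Nat.one_lt_pow hd0 hr1)
  have hgeom : (r ^ d - 1) * ∑ i ∈ Finset.range e, (r ^ d) ^ i = r ^ (d * e) - 1 := by
    rw [mul_comm, pow_mul, Nat.geomSum_eq (Nat.one_lt_pow hd0 hr1), Nat.div_mul_cancel]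
    simpa using Nat.sub_dvd_pow_sub_pow (r ^ d) 1 e
  rw [← hgeom, Nat.mul_div_cancel_left _ hpos]
  refine Nat.div_gcd_eq_gcd_of_dvd_mul hk ?_
    (Nat.coprime_gcd_pow_sub_one_geomSum hr (hkn.coprime_dvd_right (dvd_mul_left e d)))
  rw [hgeom]
  exact (Nat.modEq_iff_dvd' (Nat.one_le_pow _ _ hr)).1 hrn.symm

theorem Nat.card_eq_of_surjective_of_eq_iff {ι α β : Type*} {f : ι → α} {g : ι → β}
    (hf : Function.Surjective f) (hg : Function.Surjective g)
    (h : ∀ x y, f x = f y ↔ g x = g y) : Nat.card α = Nat.card β := by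
  have hker : Setoid.ker f = Setoid.ker g := Setoid.ext h
  exact Nat.card_congr ((Setoid.quotientKerEquivOfSurjective f hf).symm.trans
    ((Quotient.congrRight fun x y => h x y).trans (Setoid.quotientKerEquivOfSurjective g hg)))

namespace Subgroup

variable {G : Type*} [Group G]

theorem mem_normalizer_closure_of_conj_mem {S : Set G} {g : G} (hg : IsOfFinOrder g)
    (h : ∀ x ∈ S, g⁻¹ * x * g ∈ closure S) : g ∈ normalizer (closure S : Set G) := by
  have hconj : ∀ x ∈ closure S, g⁻¹ * x * g ∈ closure S := by
    have hle : closure S ≤ (closure S).comap (MulAut.conj g⁻¹).toMonoidHom :=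
      (closure_le _).2 fun x hx => by simpa using h x hx
    exact fun x hx => by simpa using hle hx
  have hpow : ∀ k : ℕ, ∀ x ∈ closure S, (g ^ k)⁻¹ * x * g ^ k ∈ closure S := by
    intro k
    induction k with
    | zero => simp
    | succ k ih =>
      intro x hx
      have := hconj _ (ih x hx)
      rw [pow_succ]
      simpa [mul_assoc] using this
  rw [mem_normalizer_iff'']
  refine fun x => ⟨hconj x, fun hx => ?_⟩
  have hg1 : g ^ (orderOf g - 1) = g⁻¹ := by
    rw [eq_inv_iff_mul_eq_one, ← pow_succ, Nat.sub_add_cancel hg.orderOf_pos, pow_orderOf_eq_one]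
  simpa [hg1, mul_assoc] using hpow (orderOf g - 1) _ hx

theorem map_conj_eq_map_conj_iff {H : Subgroup G} {g g' : G} :
    H.map (MulAut.conj g).toMonoidHom = H.map (MulAut.conj g').toMonoidHom ↔
      g'⁻¹ * g ∈ normalizer (H : Set G) := by
  have hmap (g x : G) : x ∈ H.map (MulAut.conj g).toMonoidHom ↔ g⁻¹ * x * g ∈ H := by
    rw [mem_map_equiv, MulAut.conj_symm_apply]
  rw [mem_normalizer_iff, SetLike.ext_iff]
  simp only [hmap]
  constructor
  · intro h x
    simpa [mul_assoc] using h (g * x * g⁻¹)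
  · intro h x
    simpa [mul_assoc] using h (g⁻¹ * x * g)

end Subgroup

namespace ZM

variable {m n r : ℕ}

theorem za_pow : za m n r ^ m = 1 :=
  PresentedGroup.one_of_mem (rels := ZMrel m n r) (x := FreeGroup.of 0 ^ m) (by simp [ZMrel])

theorem zb_pow : zb m n r ^ n = 1 :=
  PresentedGroup.one_of_mem (rels := ZMrel m n r) (x := FreeGroup.of 1 ^ n) (by simp [ZMrel])

theorem conj_za : (zb m n r)⁻¹ * za m n r * zb m n r = za m n r ^ r := by
  rw [← mul_inv_eq_one]
  exact PresentedGroup.one_of_mem (rels := ZMrel m n r)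
    (x := (FreeGroup.of 1)⁻¹ * FreeGroup.of 0 * FreeGroup.of 1 * (FreeGroup.of 0 ^ r)⁻¹)
    (by simp [ZMrel])

theorem conj_za_zpow (t : ℤ) :
    (zb m n r)⁻¹ * za m n r ^ t * zb m n r = za m n r ^ (r * t) := by
  have h := congrArg (· ^ t) (conj_za (m := m) (n := n) (r := r))
  have h2 := conj_zpow (i := t) (a := (zb m n r)⁻¹) (b := za m n r)
  rw [inv_inv] at h2
  rw [← h2, h, zpow_mul, zpow_natCast]

theorem pow_conj_za_zpow (k : ℕ) (t : ℤ) :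
    (zb m n r ^ k)⁻¹ * za m n r ^ t * zb m n r ^ k = za m n r ^ (r ^ k * t) := by
  induction k with
  | zero => simp
  | succ k ih =>
    calc (zb m n r ^ (k + 1))⁻¹ * za m n r ^ t * zb m n r ^ (k + 1)
        = (zb m n r)⁻¹ * ((zb m n r ^ k)⁻¹ * za m n r ^ t * zb m n r ^ k) * zb m n r := by
          rw [pow_succ]; group
      _ = _ := by rw [ih, conj_za_zpow, pow_succ']; ring_nf

theorem closure_pair_eq_top : Subgroup.closure {za m n r, zb m n r} = ⊤ := by
  rw [← PresentedGroup.closure_range_of (ZMrel m n r)]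
  congr 1
  ext x
  simp [za, zb, Fin.exists_fin_two, eq_comm]

theorem isOfFinOrder_za (hm : 0 < m) : IsOfFinOrder (za m n r) :=
  isOfFinOrder_iff_pow_eq_one.2 ⟨m, hm, za_pow⟩

theorem isOfFinOrder_zb (hn : 0 < n) : IsOfFinOrder (zb m n r) :=
  isOfFinOrder_iff_pow_eq_one.2 ⟨n, hn, zb_pow⟩

theorem normal_zpowers_za (hn : 0 < n) : (Subgroup.zpowers (za m n r)).Normal := by
  rw [← Subgroup.normalizer_eq_top_iff, eq_top_iff, ← closure_pair_eq_top, Subgroup.closure_le]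
  rintro x (rfl | rfl)
  · exact Subgroup.le_normalizer (Subgroup.mem_zpowers _)
  · rw [Subgroup.zpowers_eq_closure]
    refine Subgroup.mem_normalizer_closure_of_conj_mem (isOfFinOrder_zb hn) ?_
    rintro x rfl
    rw [conj_za]
    exact pow_mem (Subgroup.subset_closure (Set.mem_singleton _)) _

theorem exists_eq_zpow_mul_zpow (hn : 0 < n) (g : ZM m n r) :
    ∃ s t : ℤ, g = za m n r ^ s * zb m n r ^ t := by
  have := normal_zpowers_za (m := m) (n := n) (r := r) hn
  have hg : g ∈ Subgroup.zpowers (za m n r) ⊔ Subgroup.zpowers (zb m n r) := by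
    rw [Subgroup.zpowers_eq_closure, Subgroup.zpowers_eq_closure, ← Subgroup.closure_union,
      Set.singleton_union, closure_pair_eq_top]
    trivial
  obtain ⟨_, ⟨s, rfl⟩, _, ⟨t, rfl⟩, h⟩ := Subgroup.mem_sup_of_normal_left.1 hg
  exact ⟨s, t, h.symm⟩

theorem zb_mem_normalizer (hn : 0 < n) (k d : ℕ) :
    zb m n r ∈ Subgroup.normalizer
      (Subgroup.closure {za m n r ^ k, zb m n r ^ d} : Set (ZM m n r)) := by
  refine Subgroup.mem_normalizer_closure_of_conj_mem (isOfFinOrder_zb hn) ?_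
  rintro x (rfl | rfl)
  · have h := conj_za_zpow (m := m) (n := n) (r := r) k
    rw [mul_comm, zpow_mul, zpow_natCast, zpow_natCast] at h
    rw [h]
    exact pow_mem (Subgroup.subset_closure (Set.mem_insert _ _)) _
  · have hcomm : (zb m n r)⁻¹ * zb m n r ^ d * zb m n r = zb m n r ^ d := by group
    rw [hcomm]
    exact Subgroup.subset_closure (Set.mem_insert_of_mem _ rfl)

/-- The action of `ZM(m,n,r)` on `ℤ/k`, for a divisor `k` of `m`, in which `a` translates by `1`
and `b` divides by `r`. -/
theorem exists_affine_hom (hn : n ≠ 0) {k : ℕ} (hkm : k ∣ m) (hrn : r ^ n ≡ 1 [MOD k]) :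
    ∃ φ : ZM m n r →* Equiv.Perm (ZMod k),
      (∀ (s : ℤ) (x : ZMod k), φ (za m n r ^ s) x = s + x) ∧
      ∀ (d : ℕ) (x : ZMod k), φ (zb m n r ^ d)⁻¹ x = r ^ d * x := by
  have hrn' : (r : ZMod k) ^ n = 1 := by
    exact_mod_cast (ZMod.natCast_eq_natCast_iff _ _ _).2 hrn
  let u : (ZMod k)ˣ := Units.ofPowEqOne (r : ZMod k) n hrn' hn
  have hun : u ^ n = 1 := Units.pow_ofPowEqOne _ _
  let α := MulAction.toPermHom (Multiplicative (ZMod k)) (ZMod k)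
  let β := MulAction.toPermHom (ZMod k)ˣ (ZMod k)
  have hα (x y : ZMod k) : α (Multiplicative.ofAdd x) y = x + y := rfl
  have hβ (x : ZMod k) : β u x = r * x := rfl
  let f : Fin 2 → Equiv.Perm (ZMod k) := ![α (Multiplicative.ofAdd 1), (β u)⁻¹]
  have hf0 : f 0 = α (Multiplicative.ofAdd 1) := rfl
  have hf1 : f 1 = (β u)⁻¹ := rfl
  have hf : ∀ x ∈ ZMrel m n r, FreeGroup.lift f x = 1 := by
    rintro x (rfl | rfl | rfl)
    · rw [map_pow, FreeGroup.lift_apply_of, hf0, ← map_pow, ← ofAdd_nsmul, nsmul_one,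
        (ZMod.natCast_eq_zero_iff m k).2 hkm, ofAdd_zero, map_one]
    · rw [map_pow, FreeGroup.lift_apply_of, hf1, inv_pow, ← map_pow, hun, map_one, inv_one]
    · simp only [map_mul, map_inv, map_pow, FreeGroup.lift_apply_of, hf0, hf1, inv_inv]
      rw [mul_inv_eq_one, mul_inv_eq_iff_eq_mul, ← map_pow, ← ofAdd_nsmul, nsmul_one]
      ext x : 1
      simp only [Equiv.Perm.mul_apply, hα, hβ, mul_add, mul_one]
  have ha : PresentedGroup.toGroup hf (za m n r) = α (Multiplicative.ofAdd 1) :=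
    PresentedGroup.toGroup.of hf
  have hb : PresentedGroup.toGroup hf (zb m n r) = (β u)⁻¹ := PresentedGroup.toGroup.of hf
  refine ⟨PresentedGroup.toGroup hf, fun s x => ?_, fun d x => ?_⟩
  · rw [map_zpow, ha, ← map_zpow, ← ofAdd_zsmul, zsmul_one, hα]
  · rw [map_inv, map_pow, hb, inv_pow, inv_inv]
    induction d with
    | zero => simp
    | succ d ih => rw [pow_succ', Equiv.Perm.mul_apply, ih, hβ, pow_succ', mul_assoc]

theorem zpow_za_mem_normalizer_iff (hm : 0 < m) (hn : 0 < n) (hr : 0 < r) {k d : ℕ}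
    (hrn : r ^ n ≡ 1 [MOD k]) (hkm : k ∣ m) (s : ℤ) :
    za m n r ^ s ∈ Subgroup.normalizer
        (Subgroup.closure {za m n r ^ k, zb m n r ^ d} : Set (ZM m n r)) ↔
      (s : ZMod k) * ((r ^ d - 1 : ℕ) : ZMod k) = 0 := by
  have hcast : ((r ^ d - 1 : ℕ) : ZMod k) = ((r ^ d - 1 : ℤ) : ZMod k) := by
    push_cast [Nat.one_le_pow d r hr]
    rfl
  constructor
  · intro h
    obtain ⟨φ, ha, hb⟩ := exists_affine_hom hn.ne' hkm hrn
    have hfix : Subgroup.closure {za m n r ^ k, zb m n r ^ d} ≤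
        (MulAction.stabilizer (Equiv.Perm (ZMod k)) (0 : ZMod k)).comap φ := by
      rw [Subgroup.closure_le]
      rintro x (rfl | rfl)
      · rw [SetLike.mem_coe, Subgroup.mem_comap, MulAction.mem_stabilizer_iff,
          Equiv.Perm.smul_def, ← zpow_natCast, ha]
        simp
      · rw [SetLike.mem_coe, ← inv_mem_iff, Subgroup.mem_comap, MulAction.mem_stabilizer_iff,
          Equiv.Perm.smul_def, hb, mul_zero]
    have hmem := hfix ((Subgroup.mem_normalizer_iff''.1 h _).1
      (inv_mem (Subgroup.subset_closure (Set.mem_insert_of_mem _ (Set.mem_singleton _)))))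
    rw [Subgroup.mem_comap, MulAction.mem_stabilizer_iff, Equiv.Perm.smul_def, map_mul, map_mul,
      Equiv.Perm.mul_apply, Equiv.Perm.mul_apply, ha, hb, ← zpow_neg, ha] at hmem
    rw [hcast]
    push_cast at hmem ⊢
    linear_combination hmem
  · intro h
    refine Subgroup.mem_normalizer_closure_of_conj_mem ((isOfFinOrder_za hm).zpow) ?_
    rw [hcast, ← Int.cast_mul, ZMod.intCast_zmod_eq_zero_iff_dvd] at h
    obtain ⟨c, hc⟩ := h
    have hak : za m n r ^ k ∈ Subgroup.closure {za m n r ^ k, zb m n r ^ d} :=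
      Subgroup.subset_closure (Set.mem_insert _ _)
    have hbd : zb m n r ^ d ∈ Subgroup.closure {za m n r ^ k, zb m n r ^ d} :=
      Subgroup.subset_closure (Set.mem_insert_of_mem _ rfl)
    rintro x (rfl | rfl)
    · have hcomm : (za m n r ^ s)⁻¹ * za m n r ^ k * za m n r ^ s = za m n r ^ k := by group
      rwa [hcomm]
    · have hconj : (za m n r ^ s)⁻¹ * zb m n r ^ d * za m n r ^ s =
          zb m n r ^ d * (za m n r ^ k) ^ (-c) := by
        have h1 := pow_conj_za_zpow (m := m) (n := n) (r := r) d (-s)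
        have h2 : (r : ℤ) ^ d * -s + s = k * -c := by linear_combination -hc
        rw [← zpow_natCast (za m n r) k, ← zpow_mul, ← h2, zpow_add, ← h1, zpow_neg]
        group
      rw [hconj]
      exact mul_mem hbd (zpow_mem hak _)

end ZM

/-- In `ZM(m,n,r)`, the conjugacy class of the subgroup
`H(mᵢ,nᵢ,0) = ⟨a^{mᵢ}, b^{nᵢ}⟩` has size `gcd(mᵢ, (r^n−1)/(r^{nᵢ}−1))`. -/
theorem card_conjClass_ZM (m n r mi ni : ℕ)
    (hm : 0 < m) (hn : 0 < n) (hr : 0 < r)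
    (h1 : Nat.gcd m n = 1) (h2 : Nat.gcd m (r - 1) = 1) (h3 : r ^ n ≡ 1 [MOD m])
    (hmi : mi ∣ m) (hni : ni ∣ n) :
    Nat.card {K : Subgroup (ZM m n r) //
        ∃ g : ZM m n r, Subgroup.map (MulAut.conj g).toMonoidHom
          (Subgroup.closure {za m n r ^ mi, zb m n r ^ ni}) = K} =
      Nat.gcd mi ((r ^ n - 1) / (r ^ ni - 1)) := by
  have hmi0 : 0 < mi := Nat.pos_of_dvd_of_pos hmi hm
  have hrn : r ^ n ≡ 1 [MOD mi] := h3.of_dvd hmi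
  rw [← div_gcd_pow_sub_one_eq hmi0 hn hr (Nat.Coprime.coprime_dvd_left hmi h1)
    (Nat.Coprime.coprime_dvd_left hmi h2) hrn hni, ← ZMod.addOrderOf_coe _ hmi0.ne',
    ← Nat.card_zmultiples]
  refine Nat.card_eq_of_surjective_of_eq_iff (ι := ℤ)
    (f := fun s => ⟨_, za m n r ^ s, rfl⟩)
    (g := fun s => ⟨s • ((r ^ ni - 1 : ℕ) : ZMod mi), s, rfl⟩) ?_ ?_ ?_
  · rintro ⟨_, g, rfl⟩
    obtain ⟨s, t, rfl⟩ := ZM.exists_eq_zpow_mul_zpow hn g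
    refine ⟨s, Subtype.ext (Subgroup.map_conj_eq_map_conj_iff.2 ?_)⟩
    rw [mul_inv_rev, inv_mul_cancel_right, ← zpow_neg]
    exact zpow_mem (ZM.zb_mem_normalizer hn mi ni) _
  · rintro ⟨_, s, rfl⟩
    exact ⟨s, rfl⟩
  · intro s t
    refine Subtype.ext_iff.trans (Iff.trans ?_ Subtype.ext_iff.symm)
    change _ ↔ s • ((r ^ ni - 1 : ℕ) : ZMod mi) = t • ((r ^ ni - 1 : ℕ) : ZMod mi)
    rw [Subgroup.map_conj_eq_map_conj_iff, ← zpow_neg,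
      ← zpow_add, ZM.zpow_za_mem_normalizer_iff hm hn hr hrn hmi, zsmul_eq_mul, zsmul_eq_mul,
      ← sub_eq_zero (b := (t : ZMod mi) * _)]
    push_cast
    ring_nf
end
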